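/- Let G be a word-hyperbolic group with a marked finite generating set A and let H ≤ G be a quasiconvex subgroup. Then there exists δ' ≥ 0 such that every geodesic bigon in the relative Cayley graph Y = Γ(G/H, A) (with its simplicial metric d_Y) is δ'-thin. -/

import Mathlib

/-! ## Words over a marked generating set and word metrics -/

/-- Evaluation of a word in the letters `A × Bool` (a letter together with a sign,
`true` = the letter itself, `false` = its inverse) under a marking `π : A → G`. -/
def evalWord {A G : Type*} [Group G] (π : A → G) (w : List (A × Bool)) : G :=
  (w.map fun p => if p.2 then π p.1 else (π p.1)⁻¹).prod

/-- The word length `|g|_X` of `g ∈ G` with respect to the marked generating set `π : A → G`. -/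
noncomputable def wordLen {A G : Type*} [Group G] (π : A → G) (g : G) : ℕ :=
  sInf {n | ∃ w : List (A × Bool), w.length = n ∧ evalWord π w = g}

/-- The word metric `d_X` on the Cayley graph `X = Γ(G,A)` (restricted to vertices). -/
noncomputable def dX {A G : Type*} [Group G] (π : A → G) (g₁ g₂ : G) : ℕ :=
  wordLen π (g₁⁻¹ * g₂)

/-! ## Discrete geodesics, paths, near-geodesics, thinness, trimness -/

/-- A (discrete) geodesic from `x` to `y` in a graph-like metric `d`:
a sequence of vertices `γ 0 = x, …, γ (d x y) = y` with `d (γ i) (γ j) = |i - j|`. -/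
def IsDiscGeodesic {X : Type*} (d : X → X → ℕ) (x y : X) (γ : ℕ → X) : Prop :=
  γ 0 = x ∧ γ (d x y) = y ∧
    ∀ i j, i ≤ d x y → j ≤ d x y → d (γ i) (γ j) = Nat.dist i j

/-- A discrete edge-path of length `n`: consecutive vertices at distance at most `1`. -/
def IsDiscPath {X : Type*} (d : X → X → ℕ) (γ : ℕ → X) (n : ℕ) : Prop :=
  ∀ i < n, d (γ i) (γ (i + 1)) ≤ 1

/-- A near-geodesic from `x` to `y`: a path `p₁ p' p₂` where `p'` is geodesic and the
initial and terminal segments `p₁, p₂` have length at most `1`. -/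
def IsNearGeodesicPath {X : Type*} (d : X → X → ℕ) (x y : X) (γ : ℕ → X) (n : ℕ) : Prop :=
  γ 0 = x ∧ γ n = y ∧ IsDiscPath d γ n ∧
    ∃ a b : ℕ, a ≤ 1 ∧ b ≤ 1 ∧ a + b ≤ n ∧
      ∀ i j, a ≤ i → i ≤ j → j + b ≤ n → d (γ i) (γ j) = j - i

/-- All geodesic triangles of `(X,d)` are `δ`-thin: every side is contained in the closed
`δ`-neighbourhood of the union of the other two sides. -/
def DiscThinTriangles {X : Type*} (d : X → X → ℕ) (δ : ℝ) : Prop :=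
  ∀ x y z (γ₁ γ₂ γ₃ : ℕ → X),
    IsDiscGeodesic d x y γ₁ → IsDiscGeodesic d y z γ₂ → IsDiscGeodesic d z x γ₃ →
    ∀ i ≤ d x y, ∃ j,
      (j ≤ d y z ∧ (d (γ₁ i) (γ₂ j) : ℝ) ≤ δ) ∨
      (j ≤ d z x ∧ (d (γ₁ i) (γ₃ j) : ℝ) ≤ δ)

/-- All geodesic bigons of `(X,d)` are `δ`-thin: each side is contained in the closed
`δ`-neighbourhood of the other. -/
def DiscThinBigons {X : Type*} (d : X → X → ℕ) (δ : ℝ) : Prop :=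
  ∀ x y (α β : ℕ → X), IsDiscGeodesic d x y α → IsDiscGeodesic d x y β →
    (∀ i ≤ d x y, ∃ j ≤ d x y, (d (α i) (β j) : ℝ) ≤ δ) ∧
    (∀ i ≤ d x y, ∃ j ≤ d x y, (d (β i) (α j) : ℝ) ≤ δ)

/-- The Gromov product `(x,y)_z` with respect to the `ℕ`-valued metric `d`. -/
noncomputable def gromovProd {X : Type*} (d : X → X → ℕ) (x y z : X) : ℝ :=
  ((d z x : ℝ) + (d z y : ℝ) - (d x y : ℝ)) / 2

/-- All geodesic triangles of `(X,d)` are `δ`-trim: two points on two sides which are at the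
same distance, at most the Gromov product `(x,y)_z`, from the common vertex `z`, are
`δ`-close (this is required for every labelling of the vertices of the triangle). -/
def DiscTrimTriangles {X : Type*} (d : X → X → ℕ) (δ : ℕ) : Prop :=
  ∀ x y z (γ₁ γ₂ : ℕ → X), IsDiscGeodesic d z x γ₁ → IsDiscGeodesic d z y γ₂ →
    ∀ i, i ≤ d z x → i ≤ d z y → (i : ℝ) ≤ gromovProd d x y z →
      d (γ₁ i) (γ₂ i) ≤ δ

/-- `S ⊆ G` is `C`-quasiconvex w.r.t. `d`: every geodesic with endpoints in `S`
stays in the closed `C`-neighbourhood of `S`. -/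
def DiscQuasiconvex {G : Type*} (d : G → G → ℕ) (S : Set G) (C : ℝ) : Prop :=
  ∀ x y (γ : ℕ → G), x ∈ S → y ∈ S → IsDiscGeodesic d x y γ →
    ∀ i ≤ d x y, ∃ h ∈ S, (d (γ i) h : ℝ) ≤ C

/-! ## The relative Cayley graph (Schreier coset graph) -/

/-- The right coset `Hg` of `g`, as a vertex of the relative Cayley graph `Γ(G/H,A)`. -/
def rcoset {G : Type*} [Group G] (H : Subgroup G) (g : G) :
    Quotient (QuotientGroup.rightRel H) :=
  Quotient.mk (QuotientGroup.rightRel H) g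

/-- Right multiplication `Hg ↦ Hga` on right cosets; this is the map tracing the
edges of the relative Cayley graph. -/
def cosetMul {G : Type*} [Group G] (H : Subgroup G)
    (x : Quotient (QuotientGroup.rightRel H)) (g : G) :
    Quotient (QuotientGroup.rightRel H) :=
  Quotient.map (· * g) (fun a b hab => by
    have hab' : b * a⁻¹ ∈ H := QuotientGroup.rightRel_apply.mp hab
    show QuotientGroup.rightRel H (a * g) (b * g)
    rw [QuotientGroup.rightRel_apply]
    simpa [mul_inv_rev, mul_assoc] using hab') x

/-- The simplicial metric `d_Y` on (the vertices of) the relative Cayley graph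
`Y = Γ(G/H, A)`: the least length of a word in the generators leading from one coset
to the other. -/
noncomputable def dY {A G : Type*} [Group G] (π : A → G) (H : Subgroup G)
    (x y : Quotient (QuotientGroup.rightRel H)) : ℕ :=
  sInf {n | ∃ w : List (A × Bool), w.length = n ∧ cosetMul H x (evalWord π w) = y}

/-! ## Word length and the word metric -/

theorem evalWord_append {A G : Type*} [Group G] (π : A → G) (u v : List (A × Bool)) :
    evalWord π (u ++ v) = evalWord π u * evalWord π v := by
  simp [evalWord]

theorem exists_evalWord_inv {A G : Type*} [Group G] (π : A → G) (w : List (A × Bool)) :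
    ∃ v : List (A × Bool), v.length = w.length ∧ evalWord π v = (evalWord π w)⁻¹ := by
  induction w with
  | nil => exact ⟨[], rfl, by simp [evalWord]⟩
  | cons p w ih =>
    obtain ⟨v, hl, hv⟩ := ih
    refine ⟨v ++ [(p.1, !p.2)], by simp [hl], ?_⟩
    rw [evalWord_append, hv]
    cases h : p.2 <;> simp [evalWord, h]

theorem exists_evalWord_eq {A G : Type*} [Group G] {π : A → G}
    (hgen : Subgroup.closure (Set.range π) = ⊤) (g : G) :
    ∃ w : List (A × Bool), evalWord π w = g := by
  have hg : g ∈ Subgroup.closure (Set.range π) := hgen ▸ Subgroup.mem_top g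
  induction hg using Subgroup.closure_induction with
  | mem x hx =>
    obtain ⟨a, rfl⟩ := hx
    exact ⟨[(a, true)], by simp [evalWord]⟩
  | one => exact ⟨[], by simp [evalWord]⟩
  | mul x y _ _ hx hy =>
    obtain ⟨u, rfl⟩ := hx
    obtain ⟨v, rfl⟩ := hy
    exact ⟨u ++ v, evalWord_append π u v⟩
  | inv x _ hx =>
    obtain ⟨u, rfl⟩ := hx
    obtain ⟨v, -, hv⟩ := exists_evalWord_inv π u
    exact ⟨v, hv⟩

theorem wordLen_evalWord_le {A G : Type*} [Group G] (π : A → G) (w : List (A × Bool)) :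
    wordLen π (evalWord π w) ≤ w.length :=
  Nat.sInf_le ⟨w, rfl, rfl⟩

theorem exists_length_eq_wordLen {A G : Type*} [Group G] {π : A → G}
    (hgen : Subgroup.closure (Set.range π) = ⊤) (g : G) :
    ∃ w : List (A × Bool), w.length = wordLen π g ∧ evalWord π w = g := by
  obtain ⟨w, hw⟩ := exists_evalWord_eq hgen g
  exact Nat.sInf_mem (s := {n | ∃ w : List (A × Bool), w.length = n ∧ evalWord π w = g})
    ⟨_, w, rfl, hw⟩

theorem dX_self {A G : Type*} [Group G] (π : A → G) (a : G) : dX π a a = 0 := by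
  simpa [dX, evalWord] using wordLen_evalWord_le π []

theorem dX_mul_left {A G : Type*} [Group G] (π : A → G) (h a b : G) :
    dX π (h * a) (h * b) = dX π a b := by
  simp [dX, mul_assoc]

theorem dX_triangle {A G : Type*} [Group G] {π : A → G}
    (hgen : Subgroup.closure (Set.range π) = ⊤) (a b c : G) :
    dX π a c ≤ dX π a b + dX π b c := by
  obtain ⟨u, hu, hu'⟩ := exists_length_eq_wordLen hgen (a⁻¹ * b)
  obtain ⟨v, hv, hv'⟩ := exists_length_eq_wordLen hgen (b⁻¹ * c)
  have h := wordLen_evalWord_le π (u ++ v)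
  rw [evalWord_append, hu', hv', List.length_append, hu, hv] at h
  simpa [dX, mul_assoc] using h

theorem dX_comm {A G : Type*} [Group G] {π : A → G}
    (hgen : Subgroup.closure (Set.range π) = ⊤) (a b : G) : dX π a b = dX π b a := by
  have key : ∀ a b : G, dX π a b ≤ dX π b a := by
    intro a b
    obtain ⟨u, hu, hu'⟩ := exists_length_eq_wordLen hgen (b⁻¹ * a)
    obtain ⟨v, hv, hv'⟩ := exists_evalWord_inv π u
    have h := wordLen_evalWord_le π v
    rw [hv', hu', hv, hu] at h
    simpa [dX] using h
  exact le_antisymm (key a b) (key b a)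

/-! ## Geodesics in the Cayley graph -/

theorem dX_le_sub_of_isDiscPath {A G : Type*} [Group G] {π : A → G}
    (hgen : Subgroup.closure (Set.range π) = ⊤) {γ : ℕ → G} {n : ℕ}
    (hγ : IsDiscPath (dX π) γ n) {i j : ℕ} (hij : i ≤ j) (hj : j ≤ n) :
    dX π (γ i) (γ j) ≤ j - i := by
  induction j, hij using Nat.le_induction with
  | base => simp [dX_self]
  | succ j hij ih =>
    have h₁ := ih (by omega)
    have h₂ := hγ j (by omega)
    have h₃ := dX_triangle hgen (γ i) (γ j) (γ (j + 1))
    omega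

theorem isDiscGeodesic_of_isDiscPath {A G : Type*} [Group G] {π : A → G}
    (hgen : Subgroup.closure (Set.range π) = ⊤) {γ : ℕ → G} {n : ℕ}
    (hγ : IsDiscPath (dX π) γ n) (hn : dX π (γ 0) (γ n) = n) :
    IsDiscGeodesic (dX π) (γ 0) (γ n) γ := by
  have key : ∀ i j, i ≤ j → j ≤ n → dX π (γ i) (γ j) = j - i := by
    intro i j hij hj
    have h₁ := dX_le_sub_of_isDiscPath hgen hγ hij hj
    have h₂ := dX_le_sub_of_isDiscPath hgen hγ (Nat.zero_le i) (hij.trans hj)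
    have h₃ := dX_le_sub_of_isDiscPath hgen hγ hj le_rfl
    have h₄ := dX_triangle hgen (γ 0) (γ i) (γ n)
    have h₅ := dX_triangle hgen (γ i) (γ j) (γ n)
    omega
  refine ⟨rfl, by rw [hn], fun i j hi hj => ?_⟩
  rw [hn] at hi hj
  rcases le_total i j with h | h
  · rw [key i j h hj, Nat.dist_eq_sub_of_le h]
  · rw [dX_comm hgen, key j i h hi, Nat.dist_eq_sub_of_le_right h]

theorem exists_isDiscGeodesic_dX {A G : Type*} [Group G] {π : A → G}
    (hgen : Subgroup.closure (Set.range π) = ⊤) (a b : G) :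
    ∃ γ : ℕ → G, IsDiscGeodesic (dX π) a b γ := by
  obtain ⟨w, hw, hw'⟩ := exists_length_eq_wordLen hgen (a⁻¹ * b)
  have h0 : a * evalWord π (w.take 0) = a := by simp [evalWord]
  have hn : a * evalWord π (w.take w.length) = b := by simp [hw']
  have hpath : IsDiscPath (dX π) (fun i => a * evalWord π (w.take i)) w.length := by
    intro i hi
    dsimp only
    rw [dX_mul_left, List.take_succ_eq_append_getElem hi, evalWord_append, dX,
      inv_mul_cancel_left]
    exact wordLen_evalWord_le π [w[i]]
  have h := isDiscGeodesic_of_isDiscPath hgen hpath (by simp only [h0, hn]; exact hw.symm)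
  simp only [h0, hn] at h
  exact ⟨_, h⟩

theorem IsDiscGeodesic.mul_left {A G : Type*} [Group G] {π : A → G} {a b : G} {γ : ℕ → G}
    (hγ : IsDiscGeodesic (dX π) a b γ) (h : G) :
    IsDiscGeodesic (dX π) (h * a) (h * b) (fun i => h * γ i) := by
  obtain ⟨h₀, h₁, h₂⟩ := hγ
  simp only [IsDiscGeodesic, dX_mul_left]
  exact ⟨by rw [h₀], by rw [h₁], h₂⟩

theorem IsDiscGeodesic.reverse {X : Type*} {d : X → X → ℕ} (hd : ∀ a b, d a b = d b a)
    {a b : X} {γ : ℕ → X} (hγ : IsDiscGeodesic d a b γ) :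
    IsDiscGeodesic d b a (fun i => γ (d a b - i)) := by
  obtain ⟨h₀, h₁, h₂⟩ := hγ
  rw [IsDiscGeodesic, hd b a]
  refine ⟨by simpa using h₁, by simpa using h₀, fun i j hi hj => ?_⟩
  rw [h₂ _ _ (Nat.sub_le _ _) (Nat.sub_le _ _)]
  simp only [Nat.dist]
  omega

/-! ## The relative Cayley graph -/

theorem dY_rcoset_le {A G : Type*} [Group G] {π : A → G}
    (hgen : Subgroup.closure (Set.range π) = ⊤) (H : Subgroup G) (a b : G) :
    dY π H (rcoset H a) (rcoset H b) ≤ dX π a b := by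
  obtain ⟨w, hw, hw'⟩ := exists_length_eq_wordLen hgen (a⁻¹ * b)
  refine Nat.sInf_le ⟨w, hw, ?_⟩
  change rcoset H (a * evalWord π w) = rcoset H b
  rw [hw', mul_inv_cancel_left]

theorem exists_dX_eq_dY {A G : Type*} [Group G] {π : A → G}
    (hgen : Subgroup.closure (Set.range π) = ⊤) (H : Subgroup G) (a : G)
    (y : Quotient (QuotientGroup.rightRel H)) :
    ∃ b, rcoset H b = y ∧ dX π a b = dY π H (rcoset H a) y := by
  have hne : ∃ w : List (A × Bool), cosetMul H (rcoset H a) (evalWord π w) = y := by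
    obtain ⟨b, rfl⟩ := Quotient.exists_rep y
    obtain ⟨w, hw⟩ := exists_evalWord_eq hgen (a⁻¹ * b)
    refine ⟨w, ?_⟩
    change rcoset H (a * evalWord π w) = rcoset H b
    rw [hw, mul_inv_cancel_left]
  obtain ⟨w₀, hw₀⟩ := hne
  obtain ⟨w, hw, hw'⟩ := Nat.sInf_mem
    (s := {n | ∃ w : List (A × Bool), w.length = n ∧
      cosetMul H (rcoset H a) (evalWord π w) = y}) ⟨_, w₀, rfl, hw₀⟩
  refine ⟨a * evalWord π w, hw', le_antisymm ?_ ?_⟩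
  · have h := wordLen_evalWord_le π w
    rw [hw] at h
    simpa [dX, dY] using h
  · rw [← hw']
    exact dY_rcoset_le hgen H a (a * evalWord π w)

theorem dY_comm {A G : Type*} [Group G] {π : A → G}
    (hgen : Subgroup.closure (Set.range π) = ⊤) (H : Subgroup G)
    (x y : Quotient (QuotientGroup.rightRel H)) : dY π H x y = dY π H y x := by
  have key : ∀ x y, dY π H x y ≤ dY π H y x := by
    intro x y
    obtain ⟨b, rfl⟩ : ∃ b, rcoset H b = y := Quotient.exists_rep y
    obtain ⟨a, rfl, hab⟩ := exists_dX_eq_dY hgen H b x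
    rw [← hab, dX_comm hgen]
    exact dY_rcoset_le hgen H a b
  exact le_antisymm (key x y) (key y x)

theorem dY_triangle {A G : Type*} [Group G] {π : A → G}
    (hgen : Subgroup.closure (Set.range π) = ⊤) (H : Subgroup G)
    (x y z : Quotient (QuotientGroup.rightRel H)) :
    dY π H x z ≤ dY π H x y + dY π H y z := by
  obtain ⟨a, rfl⟩ : ∃ a, rcoset H a = x := Quotient.exists_rep x
  obtain ⟨b, rfl, hab⟩ := exists_dX_eq_dY hgen H a y
  obtain ⟨c, rfl, hbc⟩ := exists_dX_eq_dY hgen H b z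
  rw [← hab, ← hbc]
  exact (dY_rcoset_le hgen H a c).trans (dX_triangle hgen a b c)

theorem rcoset_mul_left {G : Type*} [Group G] {H : Subgroup G} {h : G} (hh : h ∈ H) (a : G) :
    rcoset H (h * a) = rcoset H a := by
  refine Quotient.sound (QuotientGroup.rightRel_apply.mpr ?_)
  simpa using inv_mem hh

/-- A geodesic of the relative Cayley graph lifts to a geodesic of the Cayley graph starting at
any prescribed representative of its initial vertex. -/
theorem IsDiscGeodesic.exists_lift {A G : Type*} [Group G] {π : A → G}
    (hgen : Subgroup.closure (Set.range π) = ⊤) {H : Subgroup G} {g : G}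
    {y : Quotient (QuotientGroup.rightRel H)} {α : ℕ → Quotient (QuotientGroup.rightRel H)}
    (hα : IsDiscGeodesic (dY π H) (rcoset H g) y α) :
    ∃ (p : G) (γ : ℕ → G), dX π g p = dY π H (rcoset H g) y ∧
      IsDiscGeodesic (dX π) g p γ ∧ ∀ i, rcoset H (γ i) = α i := by
  obtain ⟨h₀, h₁, h₂⟩ := hα
  choose f hf hf' using exists_dX_eq_dY hgen H
  let γ : ℕ → G := fun i => Nat.rec g (fun i a => f a (α (i + 1))) i
  have hγ : ∀ i, rcoset H (γ i) = α i := by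
    intro i
    cases i with
    | zero => exact h₀.symm
    | succ i => exact hf _ _
  have hpath : IsDiscPath (dX π) γ (dY π H (rcoset H g) y) := by
    intro i hi
    have h : dX π (γ i) (γ (i + 1)) = dY π H (rcoset H (γ i)) (α (i + 1)) := hf' _ _
    rw [h, hγ, h₂ _ _ hi.le hi, Nat.dist_eq_sub_of_le (Nat.le_succ i)]
    omega
  have hlen : dX π (γ 0) (γ (dY π H (rcoset H g) y)) = dY π H (rcoset H g) y := by
    refine le_antisymm ?_ ?_
    · exact dX_le_sub_of_isDiscPath hgen hpath (Nat.zero_le _) le_rfl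
    · have h := dY_rcoset_le hgen H (γ 0) (γ (dY π H (rcoset H g) y))
      rwa [hγ (dY π H (rcoset H g) y), h₁] at h
  exact ⟨_, γ, hlen, isDiscGeodesic_of_isDiscPath hgen hpath hlen, hγ⟩

/-- A point on one side of a bigon in the relative Cayley graph is close either to the other side
or to a fixed geodesic from the common initial vertex to the base vertex. -/
theorem bigon_side_near {A G : Type*} [Group G] {π : A → G}
    (hgen : Subgroup.closure (Set.range π) = ⊤) {δ C : ℕ}
    (hthin : DiscThinTriangles (dX π) δ) {H : Subgroup G}
    (hqc : DiscQuasiconvex (dX π) (H : Set G) C) {g : G} {q : ℕ → G}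
    (hq : IsDiscGeodesic (dX π) g 1 q) {y : Quotient (QuotientGroup.rightRel H)}
    {α β : ℕ → Quotient (QuotientGroup.rightRel H)}
    (hα : IsDiscGeodesic (dY π H) (rcoset H g) y α)
    (hβ : IsDiscGeodesic (dY π H) (rcoset H g) y β)
    {i : ℕ} (hi : i ≤ dY π H (rcoset H g) y) :
    (∃ j ≤ dY π H (rcoset H g) y, dY π H (α i) (β j) ≤ δ) ∨
      ∃ k ≤ dX π g 1, dY π H (α i) (rcoset H (q k)) ≤ 3 * δ + C := by
  obtain ⟨p, a, hpn, ha, haα⟩ := hα.exists_lift hgen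
  obtain ⟨e, b, hen, hb, hbβ⟩ := hβ.exists_lift hgen
  obtain ⟨h, hh, rfl⟩ : ∃ h ∈ H, h * e = p := by
    refine ⟨p * e⁻¹, QuotientGroup.rightRel_apply.mp (Quotient.exact ?_), by simp⟩
    change rcoset H e = rcoset H p
    rw [← hb.2.1, ← ha.2.1, haα, hbβ, hen, hpn, hα.2.1, hβ.2.1]
  obtain ⟨σ, hσ⟩ := exists_isDiscGeodesic_dX hgen (h * g) g
  obtain ⟨τ, hτ⟩ := exists_isDiscGeodesic_dX hgen 1 (h * g)
  obtain ⟨ρ, hρ⟩ := exists_isDiscGeodesic_dX hgen h 1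
  have hq' := hq.mul_left h
  rw [mul_one] at hq'
  have hproj := dY_rcoset_le hgen H
  obtain ⟨j, ⟨-, hj⟩ | ⟨hjn, hj⟩⟩ :=
    hthin _ _ _ _ _ _ ha ((hb.mul_left h).reverse (dX_comm hgen)) hσ i (hpn ▸ hi)
  · left
    rw [dX_mul_left, hen] at hj
    refine ⟨_, Nat.sub_le _ j, ?_⟩
    have h₁ := hproj (a i) (h * b (dY π H (rcoset H g) y - j))
    rw [rcoset_mul_left hh, haα, hbβ] at h₁
    exact h₁.trans (mod_cast hj)
  right
  have hj : dX π (a i) (σ j) ≤ δ := mod_cast hj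
  obtain ⟨k, ⟨hkn, hk⟩ | ⟨hkn, hk⟩⟩ := hthin _ _ _ _ _ _ hσ hq hτ j hjn
  · have hk : dX π (σ j) (q k) ≤ δ := mod_cast hk
    refine ⟨k, hkn, ?_⟩
    have h₁ := hproj (a i) (q k)
    have h₂ := dX_triangle hgen (a i) (σ j) (q k)
    rw [haα] at h₁
    omega
  have hk : dX π (σ j) (τ k) ≤ δ := mod_cast hk
  have h₂ := dX_triangle hgen (a i) (σ j) (τ k)
  obtain ⟨l, ⟨hln, hl⟩ | ⟨hln, hl⟩⟩ := hthin _ _ _ _ _ _ hτ hq' hρ k hkn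
  · have hl : dX π (τ k) (h * q l) ≤ δ := mod_cast hl
    refine ⟨l, ?_, ?_⟩
    · have := dX_mul_left π h g 1
      rw [mul_one] at this
      omega
    have h₁ := hproj (a i) (h * q l)
    have h₃ := dX_triangle hgen (a i) (τ k) (h * q l)
    rw [haα, rcoset_mul_left hh] at h₁
    omega
  · have hl : dX π (τ k) (ρ l) ≤ δ := mod_cast hl
    obtain ⟨h', hh', hl'⟩ := hqc _ _ _ hh H.one_mem hρ l hln
    have hl' : dX π (ρ l) h' ≤ C := mod_cast hl'
    refine ⟨dX π g 1, le_rfl, ?_⟩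
    rw [hq.2.1]
    have h₁ := hproj (a i) (h' * 1)
    have h₃ := dX_triangle hgen (a i) (τ k) h'
    have h₄ := dX_triangle hgen (τ k) (ρ l) h'
    rw [haα, rcoset_mul_left hh', mul_one] at h₁
    omega

/-- Every point on one side of a bigon in the relative Cayley graph is uniformly close to the
other side. -/
theorem bigon_side_thin {A G : Type*} [Group G] {π : A → G}
    (hgen : Subgroup.closure (Set.range π) = ⊤) {δ C : ℕ}
    (hthin : DiscThinTriangles (dX π) δ) {H : Subgroup G}
    (hqc : DiscQuasiconvex (dX π) (H : Set G) C)
    {x y : Quotient (QuotientGroup.rightRel H)}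
    {α β : ℕ → Quotient (QuotientGroup.rightRel H)}
    (hα : IsDiscGeodesic (dY π H) x y α) (hβ : IsDiscGeodesic (dY π H) x y β)
    {i : ℕ} (hi : i ≤ dY π H x y) :
    ∃ j ≤ dY π H x y, dY π H (α i) (β j) ≤ 4 * (3 * δ + C) := by
  obtain ⟨g, rfl, hg⟩ := exists_dX_eq_dY hgen H 1 x
  obtain ⟨q, hq⟩ := exists_isDiscGeodesic_dX hgen g 1
  have hg' : dX π g 1 = dY π H (rcoset H g) (rcoset H 1) := by
    rw [dX_comm hgen, hg, dY_comm hgen]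
  have hproj := dY_rcoset_le hgen H
  have htri := dY_triangle hgen H
  have hcomm := dY_comm hgen H
  rcases bigon_side_near hgen hthin hqc hq hα hβ hi with ⟨j, hj, hj'⟩ | ⟨k, hk, hk'⟩
  · exact ⟨j, hj, by omega⟩
  refine ⟨i, hi, ?_⟩
  rcases bigon_side_near hgen hthin hqc hq hβ hα hi with ⟨j, hj, hj'⟩ | ⟨l, hl, hl'⟩
  · have h₁ := hα.2.2 _ _ hj le_rfl
    have h₂ := hβ.2.2 _ _ hi le_rfl
    have h₃ := hα.2.2 _ _ hi hj
    rw [hα.2.1, Nat.dist_eq_sub_of_le hj] at h₁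
    rw [hβ.2.1, Nat.dist_eq_sub_of_le hi] at h₂
    have h₄ := htri (α j) (β i) y
    have h₅ := htri (β i) (α j) y
    have h₆ := htri (α i) (α j) (β i)
    have h₇ := hcomm (α j) (β i)
    simp only [Nat.dist] at h₃
    omega
  · have hqd : ∀ m ≤ dX π g 1, dY π H (rcoset H g) (rcoset H (q m)) = m := by
      intro m hm
      have h₁ := hproj (q 0) (q m)
      have h₂ := hproj (q m) (q (dX π g 1))
      rw [hq.2.2 _ _ (Nat.zero_le _) hm, hq.1, Nat.dist_eq_sub_of_le (Nat.zero_le m)] at h₁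
      rw [hq.2.2 _ _ hm le_rfl, hq.2.1, Nat.dist_eq_sub_of_le hm] at h₂
      have h₃ := htri (rcoset H g) (rcoset H (q m)) (rcoset H 1)
      omega
    have h₁ := hα.2.2 _ _ (Nat.zero_le _) hi
    have h₂ := hβ.2.2 _ _ (Nat.zero_le _) hi
    rw [hα.1, Nat.dist_eq_sub_of_le (Nat.zero_le i)] at h₁
    rw [hβ.1, Nat.dist_eq_sub_of_le (Nat.zero_le i)] at h₂
    have h₃ := (hproj (q k) (q l)).trans_eq (hq.2.2 _ _ hk hl)
    simp only [Nat.dist] at h₃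
    have h₄ := hqd k hk
    have h₅ := hqd l hl
    have h₆ := htri (rcoset H g) (α i) (rcoset H (q k))
    have h₇ := htri (rcoset H g) (rcoset H (q k)) (α i)
    have h₈ := htri (rcoset H g) (β i) (rcoset H (q l))
    have h₉ := htri (rcoset H g) (rcoset H (q l)) (β i)
    have h₁₀ := htri (α i) (rcoset H (q k)) (β i)
    have h₁₁ := htri (rcoset H (q k)) (rcoset H (q l)) (β i)
    have h₁₂ := hcomm (rcoset H (q k)) (α i)
    have h₁₃ := hcomm (rcoset H (q l)) (β i)
    omega

/-- **Theorem 3.4.** Let `G` be a word-hyperbolic group with a marked finite generating set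
`A` (given by `π : A → G` whose range generates `G`) and let `H ≤ G` be a quasiconvex
subgroup.  Then there exists `δ' ≥ 0` such that every geodesic bigon in the relative
Cayley graph `Y = Γ(G/H, A)` (with its simplicial metric `d_Y`) is `δ'`-thin. -/
theorem relative_cayley_graph_thin_bigons
    {A G : Type*} [Group G] [Fintype A] (π : A → G)
    (hgen : Subgroup.closure (Set.range π) = ⊤)
    (hhyp : ∃ δ : ℝ, 0 ≤ δ ∧ DiscThinTriangles (dX π) δ)
    (H : Subgroup G)
    (hqc : ∃ C : ℝ, 0 < C ∧ DiscQuasiconvex (dX π) (H : Set G) C) :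
    ∃ δ' : ℝ, 0 ≤ δ' ∧ DiscThinBigons (dY π H) δ' := by
  obtain ⟨δ, -, hδ⟩ := hhyp
  obtain ⟨C, -, hC⟩ := hqc
  have hthin : DiscThinTriangles (dX π) (⌈δ⌉₊ : ℕ) := by
    intro x y z γ₁ γ₂ γ₃ h₁ h₂ h₃ i hi
    obtain ⟨j, hj⟩ := hδ x y z γ₁ γ₂ γ₃ h₁ h₂ h₃ i hi
    exact ⟨j, hj.imp (fun h => ⟨h.1, h.2.trans (Nat.le_ceil δ)⟩)
      (fun h => ⟨h.1, h.2.trans (Nat.le_ceil δ)⟩)⟩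
  have hquasi : DiscQuasiconvex (dX π) (H : Set G) (⌈C⌉₊ : ℕ) := by
    intro x y γ hx hy hγ i hi
    obtain ⟨h, hh, hd⟩ := hC x y γ hx hy hγ i hi
    exact ⟨h, hh, hd.trans (Nat.le_ceil C)⟩
  refine ⟨(4 * (3 * ⌈δ⌉₊ + ⌈C⌉₊) : ℕ), Nat.cast_nonneg _, fun x y α β hα hβ => ⟨?_, ?_⟩⟩
  · intro i hi
    obtain ⟨j, hj, h⟩ := bigon_side_thin hgen hthin hquasi hα hβ hi
    exact ⟨j, hj, Nat.cast_le.mpr h⟩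
  · intro i hi
    obtain ⟨j, hj, h⟩ := bigon_side_thin hgen hthin hquasi hβ hα hi
    exact ⟨j, hj, Nat.cast_le.mpr h⟩
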